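/- For m + n ≥ 1, the special Heisenberg Lie superalgebra H(m,n) over a field F (char F ≠ 2,3) is capable if and only if m = 1 and n = 0. -/

import Mathlib

/-!
Common definitions: Lie superalgebras over a field `F` (char ≠ 2,3 where needed),
graded ideals, centers, capability, epicenter, non-abelian tensor and exterior
products (characterized by generators-and-relations universal properties),
free Lie superalgebras, Schur multipliers, Heisenberg Lie superalgebras, etc.
-/

namespace SuperLie

open Submodule Function Module

universe u v w

/-- The sign `(-1)^{|a||b|}` attached to a pair of `ℤ₂`-degrees. -/
def sg (F : Type u) [Field F] (a b : ZMod 2) : F := (-1 : F) ^ (a.val * b.val)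

/-- A Lie superalgebra over `F`: a `ℤ₂`-graded vector space `L = L₀ ⊕ L₁`
together with an even bilinear bracket satisfying graded skew-symmetry and the
graded Jacobi identity (on homogeneous elements). -/
class LieSuper (F : Type u) [Field F] (L : Type v) [AddCommGroup L] [Module F L] where
  gr : ZMod 2 → Submodule F L
  isCompl_gr : IsCompl (gr 0) (gr 1)
  br : L → L → L
  br_add_left : ∀ x y z : L, br (x + y) z = br x z + br y z
  br_add_right : ∀ x y z : L, br x (y + z) = br x y + br x z
  br_smul_left : ∀ (c : F) (x y : L), br (c • x) y = c • br x y
  br_smul_right : ∀ (c : F) (x y : L), br x (c • y) = c • br x y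
  br_gr : ∀ a b : ZMod 2, ∀ x ∈ gr a, ∀ y ∈ gr b, br x y ∈ gr (a + b)
  br_skew : ∀ a b : ZMod 2, ∀ x ∈ gr a, ∀ y ∈ gr b, br x y = -(sg F a b) • br y x
  br_jacobi : ∀ a b c : ZMod 2, ∀ x ∈ gr a, ∀ y ∈ gr b, ∀ z ∈ gr c,
    sg F a c • br x (br y z) + sg F b a • br y (br z x) + sg F c b • br z (br x y) = 0

/-- The `a`-graded piece of a Lie superalgebra. -/
def grd (F : Type u) [Field F] (L : Type v) [AddCommGroup L] [Module F L] [LieSuper F L]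
    (a : ZMod 2) : Submodule F L :=
  LieSuper.gr a

/-- The bracket of a Lie superalgebra. -/
def sbr (F : Type u) [Field F] {L : Type v} [AddCommGroup L] [Module F L] [LieSuper F L]
    (x y : L) : L :=
  LieSuper.br (F := F) x y

/-- The center `Z(L) = {z ∈ L : [z,x] = 0 for all x ∈ L}`. -/
def centerS (F : Type u) [Field F] (L : Type v) [AddCommGroup L] [Module F L] [LieSuper F L] :
    Submodule F L where
  carrier := {z : L | ∀ x : L, sbr F z x = 0}
  add_mem' := by
    intro a b ha hb x
    simp only [Set.mem_setOf_eq, sbr] at ha hb ⊢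
    rw [LieSuper.br_add_left, ha x, hb x, add_zero]
  zero_mem' := by
    intro x
    have h := LieSuper.br_smul_left (F := F) (0 : F) (0 : L) x
    simp only [Set.mem_setOf_eq, sbr, zero_smul] at h ⊢
    simpa using h
  smul_mem' := by
    intro c a ha x
    simp only [Set.mem_setOf_eq, sbr] at ha ⊢
    rw [LieSuper.br_smul_left, ha x, smul_zero]

/-- Homomorphisms of Lie superalgebras: even (grading preserving) linear maps
which preserve the bracket. -/
def IsHom (F : Type u) [Field F] {L : Type v} {M : Type w}
    [AddCommGroup L] [Module F L] [LieSuper F L]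
    [AddCommGroup M] [Module F M] [LieSuper F M] (f : L →ₗ[F] M) : Prop :=
  (∀ a : ZMod 2, ∀ x ∈ grd F L a, f x ∈ grd F M a) ∧
  (∀ x y : L, f (sbr F x y) = sbr F (f x) (f y))

/-- A bundled Lie superalgebra over `F`. -/
structure LieSupAlg (F : Type u) [Field F] : Type (max u (v + 1)) where
  carrier : Type v
  [iag : AddCommGroup carrier]
  [imo : Module F carrier]
  [ils : LieSuper F carrier]

attribute [instance] LieSupAlg.iag LieSupAlg.imo LieSupAlg.ils

instance (F : Type u) [Field F] : CoeSort (LieSupAlg.{u, v} F) (Type v) :=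
  ⟨LieSupAlg.carrier⟩

/-- A Lie superalgebra `L` is capable if `L ≅ H/Z(H)` for some Lie superalgebra `H`,
i.e. there is a surjective homomorphism onto `L` whose kernel is exactly the center. -/
def Capable (F : Type u) [Field F] (L : Type v) [AddCommGroup L] [Module F L]
    [LieSuper F L] : Prop :=
  ∃ (H : LieSupAlg.{u, max u v} F) (φ : H.carrier →ₗ[F] L),
    IsHom F φ ∧ Surjective φ ∧ LinearMap.ker φ = centerS F H.carrier

/-- Graded ideals of a Lie superalgebra. -/
def IsGIdeal (F : Type u) [Field F] {L : Type v} [AddCommGroup L] [Module F L]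
    [LieSuper F L] (I : Submodule F L) : Prop :=
  (∀ x ∈ I, ∀ y : L, sbr F x y ∈ I) ∧ (∀ y : L, ∀ x ∈ I, sbr F y x ∈ I) ∧
  (∀ x ∈ I, ∃ x0 ∈ I ⊓ grd F L 0, ∃ x1 ∈ I ⊓ grd F L 1, x = x0 + x1)

/-- The graded ideal generated by a subset. -/
def idealClosure (F : Type u) [Field F] {L : Type v} [AddCommGroup L] [Module F L]
    [LieSuper F L] (S : Set L) : Submodule F L :=
  sInf {I : Submodule F L | IsGIdeal F I ∧ S ⊆ ↑I}

/-- `QuotCapable F L N` expresses that the quotient Lie superalgebra `L/N` is capable. -/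
def QuotCapable (F : Type u) [Field F] (L : Type v) [AddCommGroup L] [Module F L]
    [LieSuper F L] (N : Submodule F L) : Prop :=
  ∃ (Q : LieSupAlg.{u, max u v} F) (π : L →ₗ[F] Q.carrier),
    IsHom F π ∧ Surjective π ∧ LinearMap.ker π = N ∧ Capable F Q.carrier

/-- The epicenter `Z^*(L)`: the smallest graded ideal of `L` such that the
corresponding quotient is capable. -/
def IsEpicenter (F : Type u) [Field F] (L : Type v) [AddCommGroup L] [Module F L]
    [LieSuper F L] (Z : Submodule F L) : Prop :=
  IsGIdeal F Z ∧ QuotCapable F L Z ∧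
  ∀ N : Submodule F L, IsGIdeal F N → QuotCapable F L N → Z ≤ N

/-- The submodule `[I,J]` spanned by brackets. -/
def bracketSpan (F : Type u) [Field F] {L : Type v} [AddCommGroup L] [Module F L]
    [LieSuper F L] (I J : Submodule F L) : Submodule F L :=
  Submodule.span F {z : L | ∃ x ∈ I, ∃ y ∈ J, z = sbr F x y}

/-- The derived subalgebra `L' = [L,L]`. -/
def derived (F : Type u) [Field F] (L : Type v) [AddCommGroup L] [Module F L]
    [LieSuper F L] : Submodule F L :=
  bracketSpan F (⊤ : Submodule F L) ⊤

/-- The lower central series of a Lie superalgebra. -/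
def lowerCentral (F : Type u) [Field F] (L : Type v) [AddCommGroup L] [Module F L]
    [LieSuper F L] : ℕ → Submodule F L
  | 0 => ⊤
  | n + 1 => bracketSpan F (lowerCentral F L n) ⊤

/-- A Lie superalgebra is nilpotent if its lower central series terminates at zero. -/
def IsNilp (F : Type u) [Field F] (L : Type v) [AddCommGroup L] [Module F L]
    [LieSuper F L] : Prop :=
  ∃ n : ℕ, lowerCentral F L n = ⊥

/-- An action of a Lie superalgebra `P` on a Lie superalgebra `M`:
an even bilinear map satisfying the two action axioms. -/
structure IsAction (F : Type u) [Field F] {P : Type v} {M : Type v}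
    [AddCommGroup P] [Module F P] [LieSuper F P]
    [AddCommGroup M] [Module F M] [LieSuper F M] (act : P → M → M) : Prop where
  add_left : ∀ (p q : P) (m : M), act (p + q) m = act p m + act q m
  add_right : ∀ (p : P) (m m' : M), act p (m + m') = act p m + act p m'
  smul_left : ∀ (c : F) (p : P) (m : M), act (c • p) m = c • act p m
  smul_right : ∀ (c : F) (p : P) (m : M), act p (c • m) = c • act p m
  grade : ∀ a b : ZMod 2, ∀ p ∈ grd F P a, ∀ m ∈ grd F M b, act p m ∈ grd F M (a + b)
  br_act : ∀ a b : ZMod 2, ∀ p ∈ grd F P a, ∀ p' ∈ grd F P b, ∀ m : M,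
    act (sbr F p p') m = act p (act p' m) - sg F a b • act p' (act p m)
  act_br : ∀ a b : ZMod 2, ∀ p ∈ grd F P a, ∀ m ∈ grd F M b, ∀ m' : M,
    act p (sbr F m m') = sbr F (act p m) m' + sg F a b • sbr F m (act p m')

/-- Compatibility of mutual actions of two Lie superalgebras on each other. -/
def Compatible (F : Type u) [Field F] {M : Type v} {N : Type v}
    [AddCommGroup M] [Module F M] [LieSuper F M]
    [AddCommGroup N] [Module F N] [LieSuper F N]
    (actMN : M → N → N) (actNM : N → M → M) : Prop :=
  (∀ a b : ZMod 2, ∀ m ∈ grd F M a, ∀ n ∈ grd F N b, ∀ n' : N,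
      actMN (actNM n m) n' = -(sg F a b) • sbr F (actMN m n) n') ∧
  (∀ a b : ZMod 2, ∀ m ∈ grd F M a, ∀ n ∈ grd F N b, ∀ m' : M,
      actNM (actMN m n) m' = -(sg F a b) • sbr F (actNM n m) m')

/-- The defining relations of the non-abelian tensor product `M ⊗ N` of Lie
superalgebras (with given mutual actions), satisfied by a pairing `q` into `T`. -/
structure TensorRel (F : Type u) [Field F] {M : Type v} {N : Type v} {T : Type w}
    [AddCommGroup M] [Module F M] [LieSuper F M]
    [AddCommGroup N] [Module F N] [LieSuper F N]
    [AddCommGroup T] [Module F T] [LieSuper F T]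
    (actMN : M → N → N) (actNM : N → M → M) (q : M → N → T) : Prop where
  add_left : ∀ (m m' : M) (n : N), q (m + m') n = q m n + q m' n
  add_right : ∀ (m : M) (n n' : N), q m (n + n') = q m n + q m n'
  smul_left : ∀ (c : F) (m : M) (n : N), q (c • m) n = c • q m n
  smul_right : ∀ (c : F) (m : M) (n : N), q m (c • n) = c • q m n
  grade : ∀ a b : ZMod 2, ∀ m ∈ grd F M a, ∀ n ∈ grd F N b, q m n ∈ grd F T (a + b)
  brk_left : ∀ a b : ZMod 2, ∀ m ∈ grd F M a, ∀ m' ∈ grd F M b, ∀ n : N,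
    q (sbr F m m') n = q m (actMN m' n) - sg F a b • q m' (actMN m n)
  brk_right : ∀ a b c : ZMod 2, ∀ m ∈ grd F M a, ∀ n ∈ grd F N b, ∀ n' ∈ grd F N c,
    q m (sbr F n n') = sg F c (a + b) • q (actNM n' m) n - sg F a b • q (actNM n m) n'
  brk_brk : ∀ a b : ZMod 2, ∀ m ∈ grd F M a, ∀ n ∈ grd F N b, ∀ (m' : M) (n' : N),
    sbr F (q m n) (q m' n') = -(sg F a b) • q (actNM n m) (actMN m' n')

/-- `IsTensorObj F actMN actNM t` says that `(T, t)` is the non-abelian tensor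
product `M ⊗ N`: the pairing `t` satisfies the defining relations and is
universal among all pairings satisfying them. -/
structure IsTensorObj (F : Type u) [Field F] {M : Type v} {N : Type v} {T : Type v}
    [AddCommGroup M] [Module F M] [LieSuper F M]
    [AddCommGroup N] [Module F N] [LieSuper F N]
    [AddCommGroup T] [Module F T] [LieSuper F T]
    (actMN : M → N → N) (actNM : N → M → M) (t : M → N → T) : Prop where
  rel : TensorRel F actMN actNM t
  lift : ∀ (Q : LieSupAlg.{u, max u v} F) (q : M → N → Q.carrier),
    TensorRel F actMN actNM q →
    ∃! h : T →ₗ[F] Q.carrier, IsHom F h ∧ ∀ (m : M) (n : N), h (t m n) = q m n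

/-- The defining relations of the non-abelian exterior square `L ∧ L` of a Lie
superalgebra (the tensor relations for the bracket actions, together with the
graded alternating relations coming from `L □ L`). -/
structure ExtRel (F : Type u) [Field F] {L : Type v} {T : Type w}
    [AddCommGroup L] [Module F L] [LieSuper F L]
    [AddCommGroup T] [Module F T] [LieSuper F T] (q : L → L → T) : Prop where
  toTensor : TensorRel F (fun x y : L => sbr F x y) (fun x y : L => sbr F x y) q
  alt : ∀ a b : ZMod 2, ∀ x ∈ grd F L a, ∀ y ∈ grd F L b, q x y = -(sg F a b) • q y x
  alt_even : ∀ x ∈ grd F L 0, q x x = 0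

/-- `IsExtObj F t` says that `(E, t)` is the non-abelian exterior square `L ∧ L`. -/
structure IsExtObj (F : Type u) [Field F] {L : Type v} {E : Type v}
    [AddCommGroup L] [Module F L] [LieSuper F L]
    [AddCommGroup E] [Module F E] [LieSuper F E] (t : L → L → E) : Prop where
  rel : ExtRel F t
  lift : ∀ (Q : LieSupAlg.{u, max u v} F) (q : L → L → Q.carrier),
    ExtRel F q →
    ∃! h : E →ₗ[F] Q.carrier, IsHom F h ∧ ∀ x y : L, h (t x y) = q x y

/-- A free Lie superalgebra: free on some `ℤ₂`-graded subset `X`. -/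
def IsFreeLieSuper (F : Type u) [Field F] (Fr : Type v) [AddCommGroup Fr] [Module F Fr]
    [LieSuper F Fr] : Prop :=
  ∃ X : ZMod 2 → Set Fr,
    (∀ a : ZMod 2, X a ⊆ (grd F Fr a : Set Fr)) ∧
    ∀ (Q : LieSupAlg.{u, max u v} F) (f : ∀ a : ZMod 2, X a → Q.carrier),
      (∀ (a : ZMod 2) (x : X a), f a x ∈ grd F Q.carrier a) →
      ∃! h : Fr →ₗ[F] Q.carrier,
        IsHom F h ∧ ∀ (a : ZMod 2) (x : X a), h (x : Fr) = f a x

/-- `F' ∩ R`, for a free presentation with kernel `R`. -/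
abbrev schurA (F : Type u) [Field F] (Fr : Type v) [AddCommGroup Fr] [Module F Fr]
    [LieSuper F Fr] (R : Submodule F Fr) : Submodule F Fr :=
  derived F Fr ⊓ R

/-- The Schur multiplier `M(L) = (F' ∩ R)/[R,F]` attached to a free presentation
`0 → R → F → L → 0`. -/
abbrev SchurMul (F : Type u) [Field F] (Fr : Type v) [AddCommGroup Fr] [Module F Fr]
    [LieSuper F Fr] (R : Submodule F Fr) :=
  ↥(schurA F Fr R) ⧸ (Submodule.comap (schurA F Fr R).subtype (bracketSpan F R ⊤))

/-- `L` is (isomorphic to) the special Heisenberg Lie superalgebra `H(m,n)` with even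
center: basis `x₁,…,x_{2m}, z` (even), `y₁,…,y_n` (odd), with `[xᵢ, x_{m+i}] = z`,
`[y_j, y_j] = z` and `z` central. -/
def IsHeisE (F : Type u) [Field F] (m n : ℕ) (L : Type v) [AddCommGroup L] [Module F L]
    [LieSuper F L] : Prop :=
  ∃ (x : Fin (2 * m) → L) (y : Fin n → L) (z : L),
    (∀ i, x i ∈ grd F L 0) ∧ z ∈ grd F L 0 ∧ (∀ j, y j ∈ grd F L 1) ∧
    LinearIndependent F (Sum.elim x (Sum.elim y (fun _ : Unit => z))) ∧
    Submodule.span F (Set.range (Sum.elim x (Sum.elim y (fun _ : Unit => z)))) = ⊤ ∧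
    (∀ i j : Fin (2 * m), sbr F (x i) (x j) =
      if (j : ℕ) = (i : ℕ) + m then z else if (i : ℕ) = (j : ℕ) + m then -z else 0) ∧
    (∀ (i : Fin (2 * m)) (j : Fin n), sbr F (x i) (y j) = 0) ∧
    (∀ (i : Fin (2 * m)) (j : Fin n), sbr F (y j) (x i) = 0) ∧
    (∀ i j : Fin n, sbr F (y i) (y j) = if i = j then z else 0) ∧
    (∀ w : L, sbr F z w = 0) ∧ (∀ w : L, sbr F w z = 0)

/-- `L` is (isomorphic to) the Heisenberg Lie superalgebra `H_m` with odd center: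
basis `x₁,…,x_m` (even), `y₁,…,y_m, z` (odd), with `[x_j, y_j] = z` and `z` central. -/
def IsHeisO (F : Type u) [Field F] (m : ℕ) (L : Type v) [AddCommGroup L] [Module F L]
    [LieSuper F L] : Prop :=
  ∃ (x : Fin m → L) (y : Fin m → L) (z : L),
    (∀ i, x i ∈ grd F L 0) ∧ (∀ j, y j ∈ grd F L 1) ∧ z ∈ grd F L 1 ∧
    LinearIndependent F (Sum.elim x (Sum.elim y (fun _ : Unit => z))) ∧
    Submodule.span F (Set.range (Sum.elim x (Sum.elim y (fun _ : Unit => z)))) = ⊤ ∧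
    (∀ i j : Fin m, sbr F (x i) (x j) = 0) ∧
    (∀ i j : Fin m, sbr F (x i) (y j) = if i = j then z else 0) ∧
    (∀ i j : Fin m, sbr F (y j) (x i) = if i = j then -z else 0) ∧
    (∀ i j : Fin m, sbr F (y i) (y j) = 0) ∧
    (∀ w : L, sbr F z w = 0) ∧ (∀ w : L, sbr F w z = 0)

/-- `A` is (isomorphic to) the abelian Lie superalgebra `A(r | s)` of
superdimension `(r | s)`. -/
def IsAbelSuper (F : Type u) [Field F] (r s : ℕ) (A : Type v) [AddCommGroup A]
    [Module F A] [LieSuper F A] : Prop :=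
  (∀ x y : A, sbr F x y = 0) ∧ Module.Finite F A ∧
  Module.finrank F ↥(grd F A 0) = r ∧ Module.finrank F ↥(grd F A 1) = s

/-- The direct sum (product) of two Lie superalgebras. -/
instance prodLieSuper (F : Type u) [Field F] (A : Type v) (B : Type w)
    [AddCommGroup A] [Module F A] [LieSuper F A]
    [AddCommGroup B] [Module F B] [LieSuper F B] : LieSuper F (A × B) where
  gr a := (grd F A a).prod (grd F B a)
  isCompl_gr := by
    have hA : IsCompl (grd F A 0) (grd F A 1) := LieSuper.isCompl_gr
    have hB : IsCompl (grd F B 0) (grd F B 1) := LieSuper.isCompl_gr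
    constructor
    · rw [disjoint_iff, eq_bot_iff]
      rintro ⟨a, b⟩ h
      rw [Submodule.mem_inf] at h
      obtain ⟨h0, h1⟩ := h
      rw [Submodule.mem_prod] at h0 h1
      have ha : a = 0 := by
        have := hA.disjoint.le_bot (Submodule.mem_inf.mpr ⟨h0.1, h1.1⟩)
        simpa using this
      have hb : b = 0 := by
        have := hB.disjoint.le_bot (Submodule.mem_inf.mpr ⟨h0.2, h1.2⟩)
        simpa using this
      simp [ha, hb, Prod.ext_iff]
    · rw [codisjoint_iff, eq_top_iff]
      rintro ⟨a, b⟩ -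
      have ha' : a ∈ grd F A 0 ⊔ grd F A 1 := by
        rw [hA.codisjoint.eq_top]; trivial
      have hb' : b ∈ grd F B 0 ⊔ grd F B 1 := by
        rw [hB.codisjoint.eq_top]; trivial
      obtain ⟨a0, ha0, a1, ha1, rfl⟩ := Submodule.mem_sup.mp ha'
      obtain ⟨b0, hb0, b1, hb1, rfl⟩ := Submodule.mem_sup.mp hb'
      refine Submodule.mem_sup.mpr ⟨(a0, b0), ?_, (a1, b1), ?_, ?_⟩
      · exact Submodule.mem_prod.mpr ⟨ha0, hb0⟩
      · exact Submodule.mem_prod.mpr ⟨ha1, hb1⟩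
      · rfl
  br x y := (sbr F x.1 y.1, sbr F x.2 y.2)
  br_add_left := by
    intro x y z
    simp only [Prod.fst_add, Prod.snd_add, sbr, LieSuper.br_add_left]
    rfl
  br_add_right := by
    intro x y z
    simp only [Prod.fst_add, Prod.snd_add, sbr, LieSuper.br_add_right]
    rfl
  br_smul_left := by
    intro c x y
    simp only [Prod.smul_fst, Prod.smul_snd, sbr, LieSuper.br_smul_left]
    rfl
  br_smul_right := by
    intro c x y
    simp only [Prod.smul_fst, Prod.smul_snd, sbr, LieSuper.br_smul_right]
    rfl
  br_gr := by
    intro a b x hx y hy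
    rw [Submodule.mem_prod] at hx hy ⊢
    exact ⟨LieSuper.br_gr a b x.1 hx.1 y.1 hy.1, LieSuper.br_gr a b x.2 hx.2 y.2 hy.2⟩
  br_skew := by
    intro a b x hx y hy
    rw [Submodule.mem_prod] at hx hy
    have h1 := LieSuper.br_skew (F := F) a b x.1 hx.1 y.1 hy.1
    have h2 := LieSuper.br_skew (F := F) a b x.2 hx.2 y.2 hy.2
    simp only [sbr]
    rw [Prod.ext_iff]
    exact ⟨h1, h2⟩
  br_jacobi := by
    intro a b c x hx y hy z hz
    rw [Submodule.mem_prod] at hx hy hz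
    have h1 := LieSuper.br_jacobi (F := F) a b c x.1 hx.1 y.1 hy.1 z.1 hz.1
    have h2 := LieSuper.br_jacobi (F := F) a b c x.2 hx.2 y.2 hy.2 z.2 hz.2
    simp only [sbr]
    rw [Prod.ext_iff]
    exact ⟨h1, h2⟩

theorem sg_ne_zero' (F : Type u) [Field F] (a b : ZMod 2) : sg F a b ≠ 0 := by
  unfold sg
  exact pow_ne_zero _ (neg_ne_zero.mpr one_ne_zero)

theorem z2 (a : ZMod 2) : a = 0 ∨ a = 1 := by revert a; decide

section cap

variable {F : Type u} [Field F] {L : Type v} [AddCommGroup L] [Module F L] [LieSuper F L]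

theorem sbr_add_left (x y z : L) : sbr F (x + y) z = sbr F x z + sbr F y z :=
  LieSuper.br_add_left x y z
theorem sbr_add_right (x y z : L) : sbr F x (y + z) = sbr F x y + sbr F x z :=
  LieSuper.br_add_right x y z
theorem sbr_smul_right (c : F) (x y : L) : sbr F x (c • y) = c • sbr F x y :=
  LieSuper.br_smul_right c x y
theorem sbr_zero_right (x : L) : sbr F x 0 = 0 := by
  have := sbr_smul_right (0 : F) x (0 : L)
  simpa using this
theorem sbr_gr {a b : ZMod 2} {x y : L} (hx : x ∈ grd F L a) (hy : y ∈ grd F L b) :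
    sbr F x y ∈ grd F L (a + b) := LieSuper.br_gr a b x hx y hy
theorem sbr_skew {a b : ZMod 2} {x y : L} (hx : x ∈ grd F L a) (hy : y ∈ grd F L b) :
    sbr F x y = -(sg F a b) • sbr F y x := LieSuper.br_skew a b x hx y hy
theorem sbr_jacobi {a b c : ZMod 2} {x y z : L} (hx : x ∈ grd F L a) (hy : y ∈ grd F L b)
    (hz : z ∈ grd F L c) :
    sg F a c • sbr F x (sbr F y z) + sg F b a • sbr F y (sbr F z x)
      + sg F c b • sbr F z (sbr F x y) = 0 := LieSuper.br_jacobi a b c x hx y hy z hz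

theorem gr_decomp (x : L) : ∃ x0 ∈ grd F L 0, ∃ x1 ∈ grd F L 1, x0 + x1 = x := by
  have h : IsCompl (grd F L 0) (grd F L 1) := LieSuper.isCompl_gr
  have hx : x ∈ grd F L 0 ⊔ grd F L 1 := by
    rw [h.codisjoint.eq_top]; trivial
  exact Submodule.mem_sup.mp hx

theorem gr_disj {x : L} (h0 : x ∈ grd F L 0) (h1 : x ∈ grd F L 1) : x = 0 := by
  have h : IsCompl (grd F L 0) (grd F L 1) := LieSuper.isCompl_gr
  simpa using h.disjoint.le_bot (Submodule.mem_inf.mpr ⟨h0, h1⟩)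

variable {K : Type w} [AddCommGroup K] [Module F K] [LieSuper F K]
  {φ : K →ₗ[F] L}

theorem hom_lift (hφ : IsHom F φ) (hs : Surjective φ) {a : ZMod 2} {x : L}
    (hx : x ∈ grd F L a) : ∃ k ∈ grd F K a, φ k = x := by
  obtain ⟨k, rfl⟩ := hs x
  obtain ⟨k0, h0, k1, h1, rfl⟩ := gr_decomp (F := F) k
  have p0 := hφ.1 0 k0 h0
  have p1 := hφ.1 1 k1 h1
  have ha : a = 0 ∨ a = 1 := z2 a
  rw [map_add] at hx
  rcases ha with rfl | rfl
  · refine ⟨k0, h0, ?_⟩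
    have : φ k1 ∈ grd F L 0 := by
      have := Submodule.sub_mem _ hx p0
      simpa using this
    simp [gr_disj this p1]
  · refine ⟨k1, h1, ?_⟩
    have : φ k0 ∈ grd F L 1 := by
      have := Submodule.sub_mem _ hx p1
      simpa using this
    simp [gr_disj p0 this]

theorem ker_left (hk : LinearMap.ker φ = centerS F K) {r : K} (hr : φ r = 0) (w : K) :
    sbr F r w = 0 := by
  have : r ∈ centerS F K := by rw [← hk]; exact hr
  exact this w

theorem ker_right (hφ : IsHom F φ) (hk : LinearMap.ker φ = centerS F K) {r : K}
    (hr : φ r = 0) (w : K) : sbr F w r = 0 := by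
  obtain ⟨r0, h0, r1, h1, rfl⟩ := gr_decomp (F := F) r
  obtain ⟨w0, g0, w1, g1, rfl⟩ := gr_decomp (F := F) w
  rw [map_add] at hr
  have p0 := hφ.1 0 r0 h0
  have p1 := hφ.1 1 r1 h1
  have q0 : φ r0 = 0 := by
    refine gr_disj (F := F) p0 ?_
    rw [eq_neg_of_add_eq_zero_left hr]
    exact Submodule.neg_mem _ p1
  have q1 : φ r1 = 0 := by simpa [q0] using hr
  simp only [sbr_add_left, sbr_add_right]
  rw [sbr_skew g0 h0, sbr_skew g0 h1, sbr_skew g1 h0, sbr_skew g1 h1]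
  simp [ker_left hk q0, ker_left hk q1]

theorem triple_zero (hφ : IsHom F φ) (hk : LinearMap.ker φ = centerS F K)
    {a b c : ZMod 2} {u v w : K} (hu : u ∈ grd F K a) (hv : v ∈ grd F K b)
    (hw : w ∈ grd F K c) (h1 : sbr F (φ v) (φ w) = 0) (h2 : sbr F (φ w) (φ u) = 0) :
    sbr F (sbr F u v) w = 0 := by
  have J := sbr_jacobi hu hv hw
  rw [ker_right hφ hk (r := sbr F v w) (by rw [hφ.2, h1]),
    ker_right hφ hk (r := sbr F w u) (by rw [hφ.2, h2])] at J
  simp only [smul_zero, zero_add, smul_eq_zero, sg_ne_zero', false_or] at J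
  rw [sbr_skew (sbr_gr hu hv) hw, J, smul_zero]

theorem triple_odd (h3 : (3 : F) ≠ 0) {y : K} (hy : y ∈ grd F K 1) :
    sbr F (sbr F y y) y = 0 := by
  have J := sbr_jacobi hy hy hy
  have : sbr F y (sbr F y y) = 0 := by
    rw [← add_smul, ← add_smul, smul_eq_zero] at J
    refine J.resolve_left ?_
    have : sg F 1 1 = -1 := by simp [sg, ZMod.val_one]
    rw [this]
    intro h
    apply h3
    linear_combination -h
  rw [sbr_skew (sbr_gr hy hy) hy, this, smul_zero]

theorem pair_kill (hφ : IsHom F φ) (hs : Surjective φ) (hk : LinearMap.ker φ = centerS F K)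
    {a b c : ZMod 2} {u v w z : L} (hu : u ∈ grd F L a) (hv : v ∈ grd F L b)
    (hw : w ∈ grd F L c) (h : sbr F u v = z) (h1 : sbr F v w = 0) (h2 : sbr F w u = 0)
    {zt : K} (hz : φ zt = z) : ∃ k, φ k = w ∧ sbr F zt k = 0 := by
  obtain ⟨u, gu, rfl⟩ := hom_lift hφ hs hu
  obtain ⟨v, gv, rfl⟩ := hom_lift hφ hs hv
  obtain ⟨w, gw, rfl⟩ := hom_lift hφ hs hw
  refine ⟨w, rfl, ?_⟩
  have e : zt = (zt - sbr F u v) + sbr F u v := by abel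
  rw [e, sbr_add_left, triple_zero hφ hk gu gv gw h1 h2, ker_left hk, add_zero]
  rw [map_sub, hφ.2, h, hz, sub_self]

theorem odd_kill (h3 : (3 : F) ≠ 0) (hφ : IsHom F φ) (hs : Surjective φ)
    (hk : LinearMap.ker φ = centerS F K)
    {y z : L} (hy : y ∈ grd F L 1) (h : sbr F y y = z)
    {zt : K} (hz : φ zt = z) : ∃ k, φ k = y ∧ sbr F zt k = 0 := by
  obtain ⟨u, hu, rfl⟩ := hom_lift hφ hs hy
  refine ⟨u, rfl, ?_⟩
  have e : zt = (zt - sbr F u u) + sbr F u u := by abel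
  rw [e, sbr_add_left, triple_odd h3 hu, ker_left hk, add_zero]
  rw [map_sub, hφ.2, h, hz, sub_self]

theorem all_kill (hφ : IsHom F φ) (hk : LinearMap.ker φ = centerS F K) {S : Set L}
    (hS : Submodule.span F S = ⊤) {zt : K}
    (h : ∀ s ∈ S, ∃ k, φ k = s ∧ sbr F zt k = 0) : φ zt = 0 := by
  have key : ∀ s : L, ∃ k, φ k = s ∧ sbr F zt k = 0 := by
    intro s
    have hs : s ∈ Submodule.span F S := by rw [hS]; trivial
    induction hs using Submodule.span_induction with
    | mem x hx => exact h x hx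
    | zero => exact ⟨0, map_zero _, sbr_zero_right _⟩
    | add x y _ _ hx hy =>
      obtain ⟨k, rfl, h1⟩ := hx
      obtain ⟨l, rfl, h2⟩ := hy
      exact ⟨k + l, map_add _ _ _, by rw [sbr_add_right, h1, h2, add_zero]⟩
    | smul c x _ hx =>
      obtain ⟨k, rfl, h1⟩ := hx
      exact ⟨c • k, map_smul _ _ _, by rw [sbr_smul_right, h1, smul_zero]⟩
  have : zt ∈ LinearMap.ker φ := by
    rw [hk]
    intro w
    obtain ⟨k, h1, h2⟩ := key (φ w)
    have e : w = (w - k) + k := by abel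
    rw [e, sbr_add_right, h2, ker_right hφ hk, add_zero]
    rw [map_sub, h1, sub_self]
  exact this

theorem forward (h3 : (3 : F) ≠ 0) (m n : ℕ) (hmn : 1 ≤ m + n) (hH : IsHeisE F m n L)
    (hφ : IsHom F φ) (hs : Surjective φ) (hk : LinearMap.ker φ = centerS F K) :
    m = 1 ∧ n = 0 := by
  by_contra hcon
  obtain ⟨x, y, z, hx, hz, hy, hli, hsp, hxx, hxy, hyx, hyy, hzl, hzr⟩ := hH
  obtain ⟨zt, hzt⟩ := hs z
  have hz0 : z ≠ 0 := by
    have := hli.ne_zero (Sum.inr (Sum.inr ()))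
    simpa using this
  apply hz0
  rw [← hzt]
  refine all_kill hφ hk hsp ?_
  -- a pair producing z exists
  have hx_pair : ∀ k : ℕ, ∀ hk : k < m,
      sbr F (x ⟨k, by omega⟩) (x ⟨k + m, by omega⟩) = z := by
    intro k hk
    rw [hxx]; simp
  rintro _ ⟨i | j | _, rfl⟩
  · simp only [Sum.elim_inl]
    by_cases hn : n = 0
    · have hm : 2 ≤ m := by omega
      obtain ⟨k, hk1, hk2, hk3⟩ : ∃ k, k < m ∧ (i : ℕ) ≠ k ∧ (i : ℕ) ≠ k + m := by
        by_cases hi : (i : ℕ) = 0 ∨ (i : ℕ) = m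
        · exact ⟨1, by omega, by omega, by omega⟩
        · exact ⟨0, by omega, by omega, by omega⟩
      have hi := i.2
      refine pair_kill hφ hs hk (hx _) (hx _) (hx i) (hx_pair k hk1) ?_ ?_ hzt
      · rw [hxx, if_neg (by simp; omega), if_neg (by simp; omega)]
      · rw [hxx, if_neg (by simp; omega), if_neg (by simp; omega)]
    · let j : Fin n := ⟨0, by omega⟩
      exact pair_kill hφ hs hk (hy j) (hy j) (hx i) (by rw [hyy]; simp) (hyx _ _) (hxy _ _) hzt
  · exact odd_kill h3 hφ hs hk (hy j) (by rw [hyy]; simp) hzt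
  · simp only [Sum.elim_inr]
    by_cases hn : n = 0
    · exact pair_kill hφ hs hk (hx _) (hx _) hz (hx_pair 0 (by omega)) (hzr _) (hzl _) hzt
    · let j : Fin n := ⟨0, by omega⟩
      exact pair_kill hφ hs hk (hy j) (hy j) hz (by rw [hyy]; simp) (hzr _) (hzl _) hzt

/-- The purely even Lie superalgebra on `L × F × F` built from three functionals. -/
@[reducible] def coverLS (a b c : L →ₗ[F] F) (z : L) (ha : a z = 0) (hb : b z = 0)
    (hc : c z = 1) : LieSuper F (L × F × F) where
  gr i := if i = 0 then ⊤ else ⊥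
  isCompl_gr := by simpa using isCompl_top_bot
  br p q := ((a p.1 * b q.1 - b p.1 * a q.1) • z,
    a p.1 * c q.1 - c p.1 * a q.1, b p.1 * c q.1 - c p.1 * b q.1)
  br_add_left x y z := by
    ext
    · simp only [Prod.fst_add, map_add, ← add_smul]; congr 1; ring
    · simp; ring
    · simp; ring
  br_add_right x y z := by
    ext
    · simp only [Prod.fst_add, map_add, ← add_smul]; congr 1; ring
    · simp; ring
    · simp; ring
  br_smul_left r x y := by
    ext
    · simp only [Prod.smul_fst, map_smul, smul_smul, smul_eq_mul]; congr 1; ring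
    · simp; ring
    · simp; ring
  br_smul_right r x y := by
    ext
    · simp only [Prod.smul_fst, map_smul, smul_smul, smul_eq_mul]; congr 1; ring
    · simp; ring
    · simp; ring
  br_gr i j x hx y hy := by
    have hi : i = 0 ∨ i = 1 := z2 i
    have hj : j = 0 ∨ j = 1 := z2 j
    rcases hi with rfl | rfl <;> rcases hj with rfl | rfl <;>
      simp_all [show (1 + 1 : ZMod 2) = 0 from rfl]
  br_skew i j x hx y hy := by
    have hi : i = 0 ∨ i = 1 := z2 i
    have hj : j = 0 ∨ j = 1 := z2 j
    rcases hi with rfl | rfl <;> rcases hj with rfl | rfl <;> simp_all [sg]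
    rw [← neg_smul]; congr 1; ring_nf; simp
  br_jacobi i j k x hx y hy w hw := by
    have hi : i = 0 ∨ i = 1 := z2 i
    have hj : j = 0 ∨ j = 1 := z2 j
    have hk : k = 0 ∨ k = 1 := z2 k
    rcases hi with rfl | rfl <;> rcases hj with rfl | rfl <;> rcases hk with rfl | rfl <;>
      simp_all [sg]
    constructor <;> ring

theorem backward {L : Type v} [AddCommGroup L] [Module F L] [LieSuper F L]
    (hH : IsHeisE F 1 0 L) : Capable F L := by
  obtain ⟨x, y, z, hx, hz, hy, hli, hsp, hxx, hxy, hyx, hyy, hzl, hzr⟩ := hH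
  let B := Basis.mk hli hsp.ge
  let a := B.coord (Sum.inl 0)
  let b := B.coord (Sum.inl 1)
  let c := B.coord (Sum.inr (Sum.inr ()))
  have B0 : B (Sum.inl 0) = x 0 := by simp [B]
  have B1 : B (Sum.inl 1) = x 1 := by simp [B]
  have Bz : B (Sum.inr (Sum.inr ())) = z := by simp [B]
  have ha0 : a (x 0) = 1 := by rw [← B0]; simp [a, Basis.coord_apply]
  have ha1 : a (x 1) = 0 := by rw [← B1]; simp [a, Basis.coord_apply]
  have haz : a z = 0 := by rw [← Bz]; simp [a, Basis.coord_apply]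
  have hb0 : b (x 0) = 0 := by rw [← B0]; simp [b, Basis.coord_apply]
  have hb1 : b (x 1) = 1 := by rw [← B1]; simp [b, Basis.coord_apply]
  have hbz : b z = 0 := by rw [← Bz]; simp [b, Basis.coord_apply]
  have hc0 : c (x 0) = 0 := by rw [← B0]; simp [c, Basis.coord_apply]
  have hc1 : c (x 1) = 0 := by rw [← B1]; simp [c, Basis.coord_apply]
  have hcz : c z = 1 := by rw [← Bz]; simp [c, Basis.coord_apply]
  have hz0 : z ≠ 0 := by
    intro h; rw [h] at hcz; simp at hcz
  have hrep : ∀ h : L, h = a h • x 0 + b h • x 1 + c h • z := by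
    intro h
    have := B.sum_repr h
    simp only [Fintype.sum_sum_type] at this
    rw [← B0, ← B1, ← Bz]
    conv_lhs => rw [← this]
    simp [a, b, c, Basis.coord_apply, Fin.sum_univ_succ, add_assoc]
  have hbr : ∀ h k : L, sbr F h k = (a h * b k - b h * a k) • z := by
    intro h k
    have e00 := hxx 0 0
    have e01 := hxx 0 1
    have e10 := hxx 1 0
    have e11 := hxx 1 1
    simp at e00 e01 e10 e11
    have sl : ∀ (r : F) (p q : L), sbr F (r • p) q = r • sbr F p q := LieSuper.br_smul_left
    conv_lhs => rw [hrep h, hrep k]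
    simp only [sbr_add_left, sbr_add_right, sl, sbr_smul_right, hzl, hzr, e00, e01, e10, e11]
    module
  have hgr : ∀ h : L, h ∈ grd F L 0 := by
    intro h
    rw [hrep h]
    exact add_mem (add_mem (Submodule.smul_mem _ _ (hx _)) (Submodule.smul_mem _ _ (hx _)))
      (Submodule.smul_mem _ _ hz)
  letI I := coverLS a b c z haz hbz hcz
  refine ⟨⟨L × F × F⟩, LinearMap.fst F L (F × F), ⟨?_, ?_⟩, ?_, ?_⟩
  · intro i p hp
    have hi : i = 0 ∨ i = 1 := z2 i
    rcases hi with rfl | rfl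
    · exact hgr _
    · have : p = 0 := hp
      rw [this]; simp
  · intro p q
    exact (hbr p.1 q.1).symm
  · exact LinearMap.fst_surjective
  · ext p
    constructor
    · intro hp
      have hp : p.1 = 0 := hp
      intro q
      change ((a p.1 * b q.1 - b p.1 * a q.1) • z,
        a p.1 * c q.1 - c p.1 * a q.1, b p.1 * c q.1 - c p.1 * b q.1) = (0 : L × F × F)
      simp [hp]
    · intro hp
      have hp : ∀ q : L × F × F, ((a p.1 * b q.1 - b p.1 * a q.1) • z,
        a p.1 * c q.1 - c p.1 * a q.1, b p.1 * c q.1 - c p.1 * b q.1) = (0 : L × F × F) := hp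
      change p.1 = 0
      have h0 := hp (x 0, 0)
      have hz' := hp (z, 0)
      simp [ha0, hb0, hc0, haz, hbz, hcz] at h0 hz'
      rw [hrep p.1, hz'.1, hz'.2, h0.2]
      simp

end cap

/-- for `m + n ≥ 1`, the special Heisenberg Lie superalgebra
`H(m,n)` is capable if and only if `m = 1` and `n = 0`. -/
theorem heisenberg_even_capable_iff (F : Type u) [Field F]
    (hchar2 : (2 : F) ≠ 0) (hchar3 : (3 : F) ≠ 0)
    (m n : ℕ) (hmn : 1 ≤ m + n)
    (H : Type v) [AddCommGroup H] [Module F H] [LieSuper F H]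
    (hH : IsHeisE F m n H) :
    Capable F H ↔ (m = 1 ∧ n = 0) := by
  constructor
  · rintro ⟨K, φ, hφ, hs, hk⟩
    exact forward hchar3 m n hmn hH hφ hs hk
  · rintro ⟨rfl, rfl⟩
    exact backward hH

end SuperLie
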